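/- (Theorem 1: minimal spreading maximizes the service rate under fixed-size access) Let N, m, r be positive integers with m ≤ N and r ≤ N, and let μ > 0 be a real number. For every integer α with 2 ≤ α ≤ r and mα ≤ N, the average service rate of the (α, mα) quasi-symmetric allocation is strictly smaller than that of minimal spreading: ∑_{k=α}^{r} (C(mα,k) · C(N−mα, r−k) / C(N,r)) · μ_s(α|k) < ∑_{k=1}^{r} (C(m,k) · C(N−m, r−k) / C(N,r)) · μ·k, where μ_s(α|k) = μ / (H_k − H_{k−α}) and H_k = ∑_{j=1}^k 1/j. -/

import Mathlib

/-- The `k`-th harmonic number `H k = ∑_{j=1}^k 1/j` as a real number. -/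
noncomputable def harmonicNumber (n : ℕ) : ℝ := ∑ j ∈ Finset.Icc 1 n, (1 : ℝ) / j

/-- The conditional service rate `μ_s(α|k) = μ / (H_k − H_{k−α})`. -/
noncomputable def condServiceRate (μ : ℝ) (α k : ℕ) : ℝ :=
  μ / (harmonicNumber k - harmonicNumber (k - α))

/-- The unnormalized mean of the hypergeometric distribution. -/
theorem sum_Icc_choose_mul_choose_mul_self {N M r : ℕ} (hM : 0 < M) (hMN : M ≤ N) (hr : 0 < r) :
    ∑ k ∈ Finset.Icc 1 r, M.choose k * (N - M).choose (r - k) * k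
      = M * (N - 1).choose (r - 1) := by
  obtain ⟨M, rfl⟩ := Nat.exists_eq_succ_of_ne_zero hM.ne'
  obtain ⟨r, rfl⟩ := Nat.exists_eq_succ_of_ne_zero hr.ne'
  obtain ⟨d, rfl⟩ := Nat.exists_eq_add_of_le hMN
  have hd : M.succ + d - 1 = M + d := by omega
  rw [Nat.add_sub_cancel_left, hd, Nat.succ_sub_one, Nat.add_choose_eq,
    Finset.Nat.sum_antidiagonal_eq_sum_range_succ_mk, Finset.mul_sum,
    ← Finset.Ico_add_one_right_eq_Icc, Finset.sum_Ico_eq_sum_range]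
  refine Finset.sum_congr (by simp) fun i _ => ?_
  have h := Nat.add_one_mul_choose_eq M i
  rw [add_comm 1 i, Nat.succ_sub_succ, mul_right_comm, ← mul_assoc]
  exact congrArg (· * d.choose (r - i)) h.symm

theorem harmonicNumber_sub (α k : ℕ) :
    harmonicNumber k - harmonicNumber (k - α)
      = ∑ j ∈ Finset.Ioc (k - α) k, (1 : ℝ) / j := by
  have hI (n : ℕ) : Finset.Icc 1 n = Finset.Ioc 0 n := rfl
  simp only [harmonicNumber, hI]
  rw [sub_eq_iff_eq_add', Finset.sum_Ioc_consecutive _ (Nat.zero_le _) (Nat.sub_le k α)]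

theorem div_lt_harmonicNumber_sub {α k : ℕ} (hα : 2 ≤ α) (h : α ≤ k) :
    (α : ℝ) / k < harmonicNumber k - harmonicNumber (k - α) := by
  rw [harmonicNumber_sub]
  have hc : (α : ℝ) / k = ∑ _j ∈ Finset.Ioc (k - α) k, (1 : ℝ) / k := by
    rw [Finset.sum_const, Nat.card_Ioc, Nat.sub_sub_self h, nsmul_eq_mul, mul_one_div]
  rw [hc]
  refine Finset.sum_lt_sum (fun j hj => ?_) ⟨k - α + 1, Finset.mem_Ioc.2 (by omega), ?_⟩
  · rw [Finset.mem_Ioc] at hj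
    have : (0 : ℝ) < j := by exact_mod_cast (by omega : 0 < j)
    exact one_div_le_one_div_of_le this (by exact_mod_cast hj.2)
  · exact one_div_lt_one_div_of_lt (by positivity) (by exact_mod_cast (by omega))

theorem condServiceRate_lt {μ : ℝ} (hμ : 0 < μ) {α k : ℕ} (hα : 2 ≤ α) (h : α ≤ k) :
    condServiceRate μ α k < μ * k / α := by
  have hα0 : (0 : ℝ) < α := by exact_mod_cast (by omega : 0 < α)
  have hk0 : (0 : ℝ) < k := by exact_mod_cast (by omega : 0 < k)
  rw [condServiceRate, ← div_div_eq_mul_div]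
  exact div_lt_div_of_pos_left hμ (by positivity) (div_lt_harmonicNumber_sub hα h)

/-- Theorem 1: in the fixed-size access model, minimal spreading (`α = 1`)
maximizes the average service rate: for every `α` with `2 ≤ α ≤ r` and
`mα ≤ N`, the average service rate of the `(α, mα)` quasi-symmetric
allocation is strictly smaller than that of minimal spreading. -/
theorem minimal_spreading_optimal_fixed (N m r : ℕ)
    (hN : 0 < N) (hm : 0 < m) (hr : 0 < r) (hmN : m ≤ N) (hrN : r ≤ N)
    (μ : ℝ) (hμ : 0 < μ) :
    ∀ α : ℕ, 2 ≤ α → α ≤ r → m * α ≤ N →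
      ∑ k ∈ Finset.Icc α r,
          ((Nat.choose (m * α) k * Nat.choose (N - m * α) (r - k) : ℕ) : ℝ)
            / ((Nat.choose N r : ℕ) : ℝ) * condServiceRate μ α k
        < ∑ k ∈ Finset.Icc 1 r,
            ((Nat.choose m k * Nat.choose (N - m) (r - k) : ℕ) : ℝ)
              / ((Nat.choose N r : ℕ) : ℝ) * (μ * k) := by
  intro α hα hαr hαN
  have hα0 : (0 : ℝ) < α := by exact_mod_cast (by omega : 0 < α)
  have hC : (0 : ℝ) < (N.choose r : ℕ) := by exact_mod_cast Nat.choose_pos hrN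
  have hmα : 0 < m * α := Nat.mul_pos hm (by omega)
  have mean (M : ℕ) (hM : 0 < M) (hMN : M ≤ N) :
      ∑ k ∈ Finset.Icc 1 r, ((M.choose k * (N - M).choose (r - k) : ℕ) : ℝ) * k
        = M * ((N - 1).choose (r - 1) : ℕ) := by
    exact_mod_cast sum_Icc_choose_mul_choose_mul_self hM hMN hr
  have hpos : (0 : ℝ) < ((N - 1).choose (r - 1) : ℕ) := by
    exact_mod_cast Nat.choose_pos (by omega)
  have factor (M : ℕ) (c : ℝ) :
      ∑ k ∈ Finset.Icc 1 r, ((M.choose k * (N - M).choose (r - k) : ℕ) : ℝ)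
          / (N.choose r : ℕ) * (μ * k / c)
        = μ / (N.choose r : ℕ) / c *
          ∑ k ∈ Finset.Icc 1 r, ((M.choose k * (N - M).choose (r - k) : ℕ) : ℝ) * k := by
    rw [Finset.mul_sum]
    exact Finset.sum_congr rfl fun k _ => by ring
  have hR : ∑ k ∈ Finset.Icc 1 r, ((m.choose k * (N - m).choose (r - k) : ℕ) : ℝ)
          / (N.choose r : ℕ) * (μ * k)
        = ∑ k ∈ Finset.Icc 1 r, (((m * α).choose k * (N - m * α).choose (r - k) : ℕ) : ℝ)
          / (N.choose r : ℕ) * (μ * k / α) := by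
    have h1 := factor m 1
    simp only [div_one] at h1
    rw [h1, factor, mean m hm hmN, mean _ hmα hαN]
    push_cast
    field_simp
  have hfilter : (Finset.Icc 1 r).filter (α ≤ ·) = Finset.Icc α r := by
    ext k
    simp only [Finset.mem_filter, Finset.mem_Icc]
    omega
  rw [hR, ← hfilter, Finset.sum_filter]
  have hlt (k : ℕ) (hk : k ∈ Finset.Icc 1 r) :
      (if α ≤ k then condServiceRate μ α k else 0) < μ * k / α := by
    have hk0 : (0 : ℝ) < k := by exact_mod_cast (Finset.mem_Icc.1 hk).1
    split_ifs with h
    · exact condServiceRate_lt hμ hα h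
    · positivity
  simp only [← mul_ite_zero]
  refine Finset.sum_lt_sum
    (fun k hk => mul_le_mul_of_nonneg_left (hlt k hk).le (by positivity)) ?_
  have hne : ∑ k ∈ Finset.Icc 1 r,
      (((m * α).choose k * (N - m * α).choose (r - k) : ℕ) : ℝ) * k ≠ 0 := by
    rw [mean _ hmα hαN]
    have : (0 : ℝ) < (m * α : ℕ) := by exact_mod_cast hmα
    positivity
  obtain ⟨k, hk, hk0⟩ := Finset.exists_ne_zero_of_sum_ne_zero hne
  refine ⟨k, hk, mul_lt_mul_of_pos_left (hlt k hk) (div_pos ?_ hC)⟩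
  exact lt_of_le_of_ne (Nat.cast_nonneg _) (left_ne_zero_of_mul hk0).symm
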